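/- Let H be a Hilbert space and A, B ∈ B(H) compact operators. If λ = (λₙ) and μ = (μₙ) are sequences of nonnegative reals with ℓ₄-norm equal to 1, then hₙ(M_{A,B}) ≥ ((λ·s(A)) ⊗ (μ·s(B)))ₙ for every n ≥ 1, where λ·s(A) denotes the termwise product sequence (λₙ sₙ(A))_{n≥1} and M_{A,B} : B(H) → B(H) is X ↦ A X B. -/

import Mathlib

open scoped BigOperators

noncomputable section

/-- The space of complex null sequences `c₀`. -/
def c0 : Set (ℕ → ℂ) := {α | Filter.Tendsto α Filter.atTop (nhds 0)}

/-- `rearrSum α n` is the supremum of `∑_{i ∈ F} |α i|` over finite sets `F ⊆ ℕ` with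
`|F| = n`; for a null sequence it equals `α*₁ + ⋯ + α*ₙ` where `α*` is the decreasing
rearrangement of `(|α_n|)`. -/
def rearrSum (α : ℕ → ℂ) (n : ℕ) : ℝ :=
  sSup ((fun F : Finset ℕ => ∑ i ∈ F, ‖α i‖) '' {F | F.card = n})

/-- The decreasing rearrangement of a null sequence, 0-indexed:
`rearr α n = α*_{n+1}`. -/
def rearr (α : ℕ → ℂ) (n : ℕ) : ℝ := rearrSum α (n + 1) - rearrSum α n

/-- A Calkin space: a linear subspace of `c₀` containing every null sequence whose
decreasing rearrangement is dominated termwise by that of one of its members. -/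
def IsCalkinSpace (I : Set (ℕ → ℂ)) : Prop :=
  I ⊆ c0 ∧ (0 : ℕ → ℂ) ∈ I ∧
  (∀ α ∈ I, ∀ β ∈ I, α + β ∈ I) ∧
  (∀ (c : ℂ), ∀ α ∈ I, c • α ∈ I) ∧
  (∀ α ∈ I, ∀ β ∈ c0, (∀ n, rearr β n ≤ rearr α n) → β ∈ I)

/-- `tensorSum α β n` is the supremum of `∑_{(i,j) ∈ F} |α i| |β j|` over finite
`F ⊆ ℕ × ℕ` with `|F| = n`; it equals `(α⊗β)₁ + ⋯ + (α⊗β)ₙ`. -/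
def tensorSum (α β : ℕ → ℂ) (n : ℕ) : ℝ :=
  sSup ((fun F : Finset (ℕ × ℕ) => ∑ p ∈ F, ‖α p.1‖ * ‖β p.2‖) '' {F | F.card = n})

/-- The tensor sequence `α⊗β`: the decreasing rearrangement of the double sequence
`(|α_m β_n|)_{m,n}`, 0-indexed: `tensorSeq α β n = (α⊗β)_{n+1}`. -/
def tensorSeq (α β : ℕ → ℂ) (n : ℕ) : ℝ := tensorSum α β (n + 1) - tensorSum α β n

/-- Embedding of real sequences into complex sequences. -/
def toC (f : ℕ → ℝ) : ℕ → ℂ := fun n => (f n : ℂ)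

/-- The tensor product `𝔦⊗𝔧` of two Calkin spaces: the smallest Calkin space
containing `α⊗β` for all `α ∈ 𝔦`, `β ∈ 𝔧`. -/
def calkinTensor (I J : Set (ℕ → ℂ)) : Set (ℕ → ℂ) :=
  ⋂₀ {K | IsCalkinSpace K ∧ ∀ α ∈ I, ∀ β ∈ J, toC (tensorSeq α β) ∈ K}

/-- A Calkin space `𝔦` is stable if `𝔦⊗𝔦 = 𝔦`. -/
def IsStableCalkin (I : Set (ℕ → ℂ)) : Prop := IsCalkinSpace I ∧ calkinTensor I I = I

/-- The principal Calkin space `⟨α⟩` generated by `α`: the smallest Calkin space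
containing `α`. -/
def principalCalkin (α : ℕ → ℂ) : Set (ℕ → ℂ) := ⋂₀ {K | IsCalkinSpace K ∧ α ∈ K}

/-- `Kw ω α n = #{m : ω^{n+1} < α m ≤ ω^n}` (the sequence `α` being 0-indexed). -/
def Kw (ω : ℝ) (α : ℕ → ℝ) (n : ℕ) : ℕ :=
  Set.ncard {m : ℕ | ω ^ (n + 1) < α m ∧ α m ≤ ω ^ n}

/-- `K̃ₙ = Σ_{i=0}^n Kᵢ`. -/
def Ktil (ω : ℝ) (α : ℕ → ℝ) (n : ℕ) : ℕ := ∑ i ∈ Finset.range (n + 1), Kw ω α i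

/-- `Mₙ = Σ_{i+j=n} Kᵢ Kⱼ`. -/
def Mw (ω : ℝ) (α : ℕ → ℝ) (n : ℕ) : ℕ :=
  ∑ i ∈ Finset.range (n + 1), Kw ω α i * Kw ω α (n - i)

/-- `M̃ₙ = Σ_{i=0}^n Mᵢ`. -/
def Mtil (ω : ℝ) (α : ℕ → ℝ) (n : ℕ) : ℕ := ∑ i ∈ Finset.range (n + 1), Mw ω α i

/-- The `n`-th approximation number of `T` (1-indexed: `approxNum T n = aₙ(T)` is the
infimum of `‖T - F‖` over bounded operators `F` of rank `< n`).  For operators between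
Hilbert spaces this equals the `n`-th singular number. -/
def approxNum {X Y : Type*} [NormedAddCommGroup X] [NormedSpace ℂ X]
    [NormedAddCommGroup Y] [NormedSpace ℂ Y] (T : X →L[ℂ] Y) (n : ℕ) : ℝ :=
  sInf {c | ∃ F : X →L[ℂ] Y, LinearMap.rank (F : X →ₗ[ℂ] Y) < (n : Cardinal) ∧ c = ‖T - F‖}

/-- The `n`-th Kolmogorov number `dₙ(T)` (1-indexed). -/
def kolNum {X Y : Type*} [NormedAddCommGroup X] [NormedSpace ℂ X]
    [NormedAddCommGroup Y] [NormedSpace ℂ Y] (T : X →L[ℂ] Y) (n : ℕ) : ℝ :=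
  sInf {c | ∃ V : Submodule ℂ Y, Module.rank ℂ V < (n : Cardinal) ∧
    c = ⨆ x : {x : X // ‖x‖ ≤ 1}, ⨅ y : V, ‖T x.1 - (y : Y)‖}

/-- The `n`-th Hilbert number `hₙ(T)` (1-indexed): the supremum of `sₙ(A ∘ T ∘ B)` over
all Hilbert spaces `K`, `H'` and all contractions `B : K → X`, `A : Y → H'`. -/
def hilbertNum {X Y : Type u} [NormedAddCommGroup X] [NormedSpace ℂ X]
    [NormedAddCommGroup Y] [NormedSpace ℂ Y] (T : X →L[ℂ] Y) (n : ℕ) : ℝ :=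
  sSup {c | ∃ (K : Type u) (_ : NormedAddCommGroup K) (_ : InnerProductSpace ℂ K)
    (_ : CompleteSpace K) (H' : Type u) (_ : NormedAddCommGroup H')
    (_ : InnerProductSpace ℂ H') (_ : CompleteSpace H')
    (B : K →L[ℂ] X) (A : Y →L[ℂ] H'), ‖B‖ ≤ 1 ∧ ‖A‖ ≤ 1 ∧
    c = approxNum ((A.comp T).comp B) n}

/-- The sequence of singular numbers of an operator, 0-indexed:
`sSeq T n = s_{n+1}(T) = a_{n+1}(T)`. -/
def sSeq {X Y : Type*} [NormedAddCommGroup X] [NormedSpace ℂ X]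
    [NormedAddCommGroup Y] [NormedSpace ℂ Y] (T : X →L[ℂ] Y) : ℕ → ℝ :=
  fun n => approxNum T (n + 1)

/-- The multiplication operator `M_{a,b} : x ↦ a * x * b` on a normed algebra. -/
def Mop {A : Type*} [NonUnitalNormedRing A] [NormedSpace ℂ A] [IsScalarTower ℂ A A]
    [SMulCommClass ℂ A A] (a b : A) : A →L[ℂ] A :=
  (ContinuousLinearMap.mul ℂ A a).comp ((ContinuousLinearMap.mul ℂ A).flip b)

open ContinuousLinearMap InnerProductSpace

section approx
variable {X Y : Type*} [NormedAddCommGroup X] [NormedSpace ℂ X]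
    [NormedAddCommGroup Y] [NormedSpace ℂ Y]

lemma approxNum_bddBelow (T : X →L[ℂ] Y) (n : ℕ) :
    BddBelow {c | ∃ F : X →L[ℂ] Y, LinearMap.rank (F : X →ₗ[ℂ] Y) < (n : Cardinal) ∧
      c = ‖T - F‖} :=
  ⟨0, by rintro c ⟨F, -, rfl⟩; exact norm_nonneg _⟩

lemma approxNum_nonneg (T : X →L[ℂ] Y) (n : ℕ) : 0 ≤ approxNum T n :=
  Real.sInf_nonneg (by rintro c ⟨F, -, rfl⟩; exact norm_nonneg _)

lemma approxNum_set_nonempty (T : X →L[ℂ] Y) (n : ℕ) :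
    {c | ∃ F : X →L[ℂ] Y, LinearMap.rank (F : X →ₗ[ℂ] Y) < ((n + 1 : ℕ) : Cardinal) ∧
      c = ‖T - F‖}.Nonempty :=
  ⟨‖T - 0‖, 0, by
    rw [ContinuousLinearMap.toLinearMap_zero, LinearMap.rank_zero]
    exact_mod_cast Nat.succ_pos n, rfl⟩

lemma approxNum_le_norm (T : X →L[ℂ] Y) (n : ℕ) : approxNum T (n + 1) ≤ ‖T‖ := by
  refine csInf_le (approxNum_bddBelow T _) ⟨0, ?_, by simp⟩
  rw [ContinuousLinearMap.toLinearMap_zero, LinearMap.rank_zero]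
  exact_mod_cast Nat.succ_pos n

lemma approxNum_sub_rank_one (T G : X →L[ℂ] Y)
    (hG : LinearMap.rank (G : X →ₗ[ℂ] Y) ≤ 1) (n : ℕ) :
    approxNum T (n + 2) ≤ approxNum (T - G) (n + 1) := by
  refine le_csInf (approxNum_set_nonempty _ _) ?_
  rintro c ⟨F, hF, rfl⟩
  refine csInf_le (approxNum_bddBelow T _) ⟨G + F, ?_, by congr 1; abel⟩
  rw [ContinuousLinearMap.toLinearMap_add]
  refine (LinearMap.rank_add_le _ _).trans_lt ?_
  have hF' : LinearMap.rank (F : X →ₗ[ℂ] Y) ≤ n := by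
    rw [Nat.cast_succ] at hF
    exact Order.lt_succ_iff.mp (by simpa using hF)
  refine (add_le_add hG hF').trans_lt ?_
  exact_mod_cast (by omega : 1 + n < n + 2)

end approx

lemma hilbertNum_ge {X Y : Type u} [NormedAddCommGroup X] [NormedSpace ℂ X]
    [NormedAddCommGroup Y] [NormedSpace ℂ Y] (T : X →L[ℂ] Y) (n : ℕ)
    (K : Type u) [NormedAddCommGroup K] [InnerProductSpace ℂ K]
    [CompleteSpace K] (H' : Type u) [NormedAddCommGroup H']
    [InnerProductSpace ℂ H'] [CompleteSpace H']
    (B : K →L[ℂ] X) (A : Y →L[ℂ] H') (hB : ‖B‖ ≤ 1) (hA : ‖A‖ ≤ 1) :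
    approxNum ((A.comp T).comp B) (n + 1) ≤ hilbertNum T (n + 1) := by
  refine le_csSup ⟨‖T‖, ?_⟩ ⟨K, _, _, ‹_›, H', _, _, ‹_›, B, A, hB, hA, rfl⟩
  rintro c ⟨K, _, _, _, H', _, _, _, B, A, hB, hA, rfl⟩
  refine (approxNum_le_norm _ _).trans ?_
  calc ‖(A.comp T).comp B‖ ≤ ‖A.comp T‖ * ‖B‖ := opNorm_comp_le _ _
    _ ≤ ‖A.comp T‖ * 1 := by gcongr
    _ ≤ ‖A‖ * ‖T‖ := by rw [mul_one]; exact opNorm_comp_le _ _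
    _ ≤ 1 * ‖T‖ := by gcongr
    _ = ‖T‖ := one_mul _

lemma hilbertNum_nonneg {X Y : Type u} [NormedAddCommGroup X] [NormedSpace ℂ X]
    [NormedAddCommGroup Y] [NormedSpace ℂ Y] (T : X →L[ℂ] Y) (n : ℕ) :
    0 ≤ hilbertNum T n := by
  refine Real.sSup_nonneg ?_
  rintro c ⟨K, _, _, _, H', _, _, _, B, A, hB, hA, rfl⟩
  exact approxNum_nonneg _ _

/-- lower bound for approximation numbers of an operator bounded below on a space of
dimension `n + 1`. -/
lemma le_approxNum {ι : Type*} [Fintype ι] {Y : Type*} [NormedAddCommGroup Y]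
    [NormedSpace ℂ Y] (T : EuclideanSpace ℂ ι →L[ℂ] Y) (t : ℝ)
    (hT : ∀ x, t * ‖x‖ ≤ ‖T x‖) (n : ℕ) (hn : Fintype.card ι = n + 1) :
    t ≤ approxNum T (n + 1) := by
  refine le_csInf (approxNum_set_nonempty _ _) ?_
  rintro c ⟨F, hF, rfl⟩
  have hker : ∃ x, x ≠ 0 ∧ F x = 0 := by
    by_contra! hcon
    have hinj : Function.Injective (F : EuclideanSpace ℂ ι →ₗ[ℂ] Y) := by
      rw [injective_iff_map_eq_zero]
      intro a ha
      by_contra h0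
      exact hcon a h0 ha
    have hfin : Module.finrank ℂ (LinearMap.range (F : EuclideanSpace ℂ ι →ₗ[ℂ] Y)) = n + 1 := by
      rw [LinearMap.finrank_range_of_inj hinj, finrank_euclideanSpace, hn]
    rw [LinearMap.rank, ← Module.finrank_eq_rank, hfin] at hF
    exact lt_irrefl _ hF
  obtain ⟨x, hx0, hFx⟩ := hker
  have h1 := (T - F).le_opNorm x
  rw [_root_.sub_apply, hFx, sub_zero] at h1
  exact le_of_mul_le_mul_right ((hT x).trans h1) (norm_pos_iff.mpr hx0)

section schmidt
variable {H : Type u} [NormedAddCommGroup H] [InnerProductSpace ℂ H] [CompleteSpace H]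

lemma exists_top_vector (A : H →L[ℂ] H) (hA : IsCompactOperator ⇑A) (h0 : A ≠ 0) :
    ∃ u : H, ‖u‖ = 1 ∧ (adjoint A) (A u) = ((‖A‖ ^ 2 : ℝ) : ℂ) • u := by
  have hnt : Nontrivial H := by
    by_contra h
    rw [not_nontrivial_iff_subsingleton] at h
    exact h0 (Subsingleton.elim _ _)
  set S : H →L[ℂ] H := adjoint A ∘L A with hS
  have hSc : IsCompactOperator S := hA.clm_comp (adjoint A)
  have hSn : ‖S‖ = ‖A‖ ^ 2 := by
    rw [hS, ContinuousLinearMap.norm_adjoint_comp_self, sq]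
  have hSsa : IsSelfAdjoint S := IsSelfAdjoint.star_mul_self A
  obtain ⟨z, hz, hzn⟩ := spectrum.exists_nnnorm_eq_spectralRadius S
  rw [IsSelfAdjoint.spectralRadius_eq_nnnorm hSsa] at hzn
  have hzn' : ‖z‖ = ‖A‖ ^ 2 := by
    rw [← hSn]
    have : ‖z‖₊ = ‖S‖₊ := by exact_mod_cast hzn
    exact congrArg NNReal.toReal this
  have hApos : 0 < ‖A‖ := norm_pos_iff.mpr h0
  have hz0 : z ≠ 0 := by
    rw [← norm_pos_iff, hzn']; positivity
  obtain ⟨v, hv⟩ := ((hSc.hasEigenvalue_iff_mem_spectrum hz0).mpr hz).exists_hasEigenvector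
  have hv0 : v ≠ 0 := hv.2
  have hSv : adjoint A (A v) = z • v := hv.apply_eq_smul
  have hin : ((‖A v‖ ^ 2 : ℝ) : ℂ) = z * ((‖v‖ ^ 2 : ℝ) : ℂ) := by
    have h1 : inner ℂ v (adjoint A (A v)) = inner ℂ (A v) (A v) := by
      rw [ContinuousLinearMap.adjoint_inner_right]
    rw [hSv, inner_smul_right, inner_self_eq_norm_sq_to_K, inner_self_eq_norm_sq_to_K] at h1
    push_cast
    exact h1.symm
  have hvpos : 0 < ‖v‖ := norm_pos_iff.mpr hv0
  have hzreal : z = ((‖A‖ ^ 2 : ℝ) : ℂ) := by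
    have hz1 : z = ((‖A v‖ ^ 2 / ‖v‖ ^ 2 : ℝ) : ℂ) := by
      have hv2 : ((‖v‖ ^ 2 : ℝ) : ℂ) ≠ 0 := by
        exact_mod_cast (pow_pos hvpos 2).ne'
      rw [Complex.ofReal_div, hin, mul_div_assoc, div_self hv2, mul_one]
    have h2 : ‖z‖ = ‖A v‖ ^ 2 / ‖v‖ ^ 2 := by
      rw [hz1, Complex.norm_real, Real.norm_of_nonneg (by positivity)]
    rw [hz1, ← h2, hzn']
  refine ⟨((‖v‖⁻¹ : ℝ) : ℂ) • v, ?_, ?_⟩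
  · rw [norm_smul, Complex.norm_real, Real.norm_of_nonneg (by positivity)]
    field_simp
  · rw [map_smul, map_smul, hSv, hzreal, smul_comm]

/-- Partial Schmidt decomposition. -/
lemma exists_schmidt : ∀ (N : ℕ) (A : H →L[ℂ] H), IsCompactOperator ⇑A →
    (N = 0 ∨ 0 < approxNum A N) →
    ∃ (u e : Fin N → H) (σ : Fin N → ℝ), Orthonormal ℂ u ∧ Orthonormal ℂ e ∧
      (∀ i, 0 < σ i) ∧ (∀ i, A (u i) = (σ i : ℂ) • e i) ∧
      (∀ i, adjoint A (e i) = (σ i : ℂ) • u i) ∧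
      ∀ i : Fin N, approxNum A (i + 1) ≤ σ i := by
  intro N
  induction N with
  | zero =>
    intro A _ _
    refine ⟨Fin.elim0, Fin.elim0, Fin.elim0, ?_, ?_, ?_, ?_, ?_, ?_⟩
    · exact ⟨fun i => i.elim0, fun i => i.elim0⟩
    · exact ⟨fun i => i.elim0, fun i => i.elim0⟩
    all_goals exact fun i => i.elim0
  | succ N ih =>
    intro A hA hpos
    replace hpos : 0 < approxNum A (N + 1) := by
      rcases hpos with h | h
      · omega
      · exact h
    have hAn : 0 < ‖A‖ := hpos.trans_le (approxNum_le_norm A N)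
    have hA0 : A ≠ 0 := norm_pos_iff.mp hAn
    have hAC : (‖A‖ : ℂ) ≠ 0 := by exact_mod_cast hAn.ne'
    obtain ⟨u₀, hu₀, hAu₀⟩ := exists_top_vector A hA hA0
    have huu : inner ℂ u₀ u₀ = (1 : ℂ) := by
      rw [inner_self_eq_norm_sq_to_K, hu₀]; simp
    set e₀ : H := ((‖A‖⁻¹ : ℝ) : ℂ) • A u₀ with he₀
    have hAue : A u₀ = (‖A‖ : ℂ) • e₀ := by
      rw [he₀, smul_smul, Complex.ofReal_inv, mul_inv_cancel₀ hAC, one_smul]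
    have hAe : adjoint A e₀ = (‖A‖ : ℂ) • u₀ := by
      rw [he₀, map_smul, hAu₀, smul_smul]
      congr 1
      push_cast
      field_simp
    have hee : inner ℂ e₀ e₀ = (1 : ℂ) := by
      have h1 : inner ℂ (adjoint A e₀) u₀ = inner ℂ e₀ (A u₀) := by
        rw [ContinuousLinearMap.adjoint_inner_left]
      rw [hAe, hAue, inner_smul_left, inner_smul_right, huu, Complex.conj_ofReal] at h1
      exact (mul_left_cancel₀ hAC h1).symm
    set G : H →L[ℂ] H := rankOne ℂ (A u₀) u₀ with hG
    have hGr : LinearMap.rank (G : H →ₗ[ℂ] H) ≤ 1 := by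
      rw [hG, rank_rankOne]
      · intro h
        rw [hAue] at h
        rcases smul_eq_zero.mp h with h | h
        · exact hAC h
        · rw [h] at hee; simp at hee
      · intro h; rw [h] at hu₀; simp at hu₀
    have hGeq : G = A ∘L rankOne ℂ u₀ u₀ := by
      rw [hG, InnerProductSpace.comp_rankOne]
    set A' : H →L[ℂ] H := A - G with hA'
    have hA'c : IsCompactOperator ⇑A' := by
      have : IsCompactOperator ⇑G := by
        rw [hGeq]; exact hA.comp_clm _
      exact hA.sub this
    have hstep : ∀ n, approxNum A (n + 2) ≤ approxNum A' (n + 1) :=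
      fun n => approxNum_sub_rank_one A G hGr n
    have hA'u : A' u₀ = 0 := by
      simp [hA', hG, hu₀]
    have hA'e : adjoint A' e₀ = 0 := by
      rw [hA', map_sub, hG, adjoint_rankOne, _root_.sub_apply, hAe, rankOne_apply,
        hAue, inner_smul_left, hee]
      simp
    obtain ⟨u, e, σ, hu, he, hσ, hAuσ, hAeσ, hsσ⟩ := ih A' hA'c (by
      rcases N with _ | N
      · exact Or.inl rfl
      · exact Or.inr (hpos.trans_le (hstep N)))
    have hσC : ∀ i, (σ i : ℂ) ≠ 0 := fun i => by exact_mod_cast (hσ i).ne'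
    have hu0 : ∀ i, inner ℂ u₀ (u i) = (0 : ℂ) := by
      intro i
      have h1 : inner ℂ u₀ (adjoint A' (e i)) = inner ℂ (A' u₀) (e i) := by
        rw [ContinuousLinearMap.adjoint_inner_right]
      rw [hAeσ, hA'u, inner_zero_left, inner_smul_right] at h1
      exact (mul_eq_zero.mp h1).resolve_left (hσC i)
    have he0 : ∀ i, inner ℂ e₀ (e i) = (0 : ℂ) := by
      intro i
      have h1 : inner ℂ (adjoint A' e₀) (u i) = inner ℂ e₀ (A' (u i)) := by
        rw [ContinuousLinearMap.adjoint_inner_left]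
      rw [hAuσ, hA'e, inner_zero_left, inner_smul_right] at h1
      exact (mul_eq_zero.mp h1.symm).resolve_left (hσC i)
    have hcons : ∀ (x₀ : H) (x : Fin N → H), inner ℂ x₀ x₀ = (1 : ℂ) →
        (∀ i, inner ℂ x₀ (x i) = (0 : ℂ)) → Orthonormal ℂ x →
        Orthonormal ℂ (Fin.cons x₀ x : Fin (N + 1) → H) := by
      intro x₀ x h1 h2 h3
      rw [orthonormal_iff_ite] at h3 ⊢
      intro i j
      refine Fin.cases ?_ (fun i => ?_) i <;> refine Fin.cases ?_ (fun j => ?_) j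
      · simpa using h1
      · simp [h2, (Fin.succ_ne_zero j).symm]
      · simp [inner_eq_zero_symm.mp (h2 i)]
      · simp [h3]
    refine ⟨Fin.cons u₀ u, Fin.cons e₀ e, Fin.cons ‖A‖ σ, hcons _ _ huu hu0 hu,
      hcons _ _ hee he0 he, ?_, ?_, ?_, ?_⟩
    · intro i
      refine Fin.cases ?_ (fun i => ?_) i
      · simpa using hA0
      · simpa using hσ i
    · intro i
      refine Fin.cases ?_ (fun i => ?_) i
      · simpa using hAue
      · have := hAuσ i
        rw [hA', _root_.sub_apply, hG, rankOne_apply, hu0, zero_smul, sub_zero] at this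
        simpa using this
    · intro i
      refine Fin.cases ?_ (fun i => ?_) i
      · simpa using hAe
      · have := hAeσ i
        rw [hA', map_sub, _root_.sub_apply, hG, adjoint_rankOne, rankOne_apply,
          hAue, inner_smul_left, he0, mul_zero, zero_smul, sub_zero] at this
        simpa using this
    · intro i
      refine Fin.cases ?_ (fun i => ?_) i
      · simpa using approxNum_le_norm A 0
      · simpa using (hstep i).trans (hsσ i)

lemma sum_comp_le {ι κ : Type*} [Fintype ι] [Fintype κ] (p : ι → κ)
    (hp : Function.Injective p) (h : κ → ℝ) (h0 : ∀ q, 0 ≤ h q) :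
    ∑ k, h (p k) ≤ ∑ q, h q := by
  have := Finset.sum_map Finset.univ (⟨p, hp⟩ : ι ↪ κ) h
  simp only [Function.Embedding.coeFn_mk] at this
  rw [← this]
  exact Finset.sum_le_univ_sum_of_nonneg h0

lemma core {N M n : ℕ} {ι : Type u} [Fintype ι] (p : ι → Fin N × Fin M)
    (hp : Function.Injective p) (hn : Fintype.card ι = n + 1)
    (A B : H →L[ℂ] H) (u e : Fin N → H) (f g : Fin M → H) (σ : Fin N → ℝ) (τ : Fin M → ℝ)
    (hu : Orthonormal ℂ u) (he : Orthonormal ℂ e) (hf : Orthonormal ℂ f)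
    (hg : Orthonormal ℂ g)
    (hA : ∀ i, adjoint A (e i) = (σ i : ℂ) • u i)
    (hB : ∀ j, B (f j) = (τ j : ℂ) • g j)
    (l : Fin N → ℝ) (μ : Fin M → ℝ)
    (hl : ∑ i, l i ^ 4 ≤ 1) (hμ : ∑ j, μ j ^ 4 ≤ 1) (t : ℝ) (ht0 : 0 ≤ t)
    (ht : ∀ k, t ≤ (l (p k).1 * σ (p k).1) * (μ (p k).2 * τ (p k).2)) :
    t ≤ hilbertNum (Mop A B) (n + 1) := by
  classical
  set φ : EuclideanSpace ℂ ι →L[ℂ] (H →L[ℂ] H) :=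
    ∑ k, (EuclideanSpace.proj k : EuclideanSpace ℂ ι →L[ℂ] ℂ).smulRight
      (rankOne ℂ (u (p k).1) (g (p k).2)) with hφ
  have hφa : ∀ x h, φ x h = ∑ k, x k • (inner ℂ (g (p k).2) h • u (p k).1) := by
    intro x h
    simp [hφ]
  set ψ : (H →L[ℂ] H) →L[ℂ] EuclideanSpace ℂ ι :=
    ((EuclideanSpace.equiv ι ℂ).symm : (ι → ℂ) →L[ℂ] EuclideanSpace ℂ ι) ∘L
      ContinuousLinearMap.pi (fun k => ((l (p k).1 * μ (p k).2 : ℝ) : ℂ) •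
        ((innerSL ℂ (e (p k).1)) ∘L (ContinuousLinearMap.apply ℂ H (f (p k).2)))) with hψ
  have hψa : ∀ Y k, ψ Y k = ((l (p k).1 * μ (p k).2 : ℝ) : ℂ) *
      inner ℂ (e (p k).1) (Y (f (p k).2)) := by
    intro Y k
    simp [hψ]
  have hφn : ‖φ‖ ≤ 1 := by
    refine ContinuousLinearMap.opNorm_le_bound _ zero_le_one fun x => ?_
    rw [one_mul]
    refine ContinuousLinearMap.opNorm_le_bound _ (norm_nonneg _) fun h => ?_
    have key : ∀ w : H, ‖inner ℂ w (φ x h)‖ ≤ ‖x‖ * (‖h‖ * ‖w‖) := by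
      intro w
      have e1 : inner ℂ w (φ x h) =
          ∑ k, x k * (inner ℂ (g (p k).2) h * inner ℂ w (u (p k).1)) := by
        rw [hφa, inner_sum]
        simp [inner_smul_right]
      have e2 : ‖inner ℂ w (φ x h)‖ ≤
          ∑ k, ‖x k‖ * (‖inner ℂ (g (p k).2) h‖ * ‖inner ℂ (u (p k).1) w‖) := by
        rw [e1]
        refine (norm_sum_le _ _).trans (le_of_eq ?_)
        refine Finset.sum_congr rfl fun k _ => ?_
        rw [norm_mul, norm_mul, norm_inner_symm w]
      have e3 : ∑ k, (‖inner ℂ (g (p k).2) h‖ * ‖inner ℂ (u (p k).1) w‖) ^ 2 ≤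
          (‖h‖ * ‖w‖) ^ 2 := by
        refine (sum_comp_le p hp (fun q => (‖inner ℂ (g q.2) h‖ * ‖inner ℂ (u q.1) w‖) ^ 2)
          (fun q => sq_nonneg _)).trans ?_
        rw [Fintype.sum_prod_type]
        have : ∀ i, ∑ j, (‖inner ℂ (g j) h‖ * ‖inner ℂ (u i) w‖) ^ 2 ≤
            ‖h‖ ^ 2 * ‖inner ℂ (u i) w‖ ^ 2 := by
          intro i
          simp_rw [mul_pow]
          rw [← Finset.sum_mul]
          gcongr
          exact hg.sum_inner_products_le h
        refine (Finset.sum_le_sum fun i _ => this i).trans ?_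
        rw [← Finset.mul_sum, mul_pow]
        gcongr
        exact hu.sum_inner_products_le w
      have e4 := Finset.sum_mul_sq_le_sq_mul_sq Finset.univ (fun k => ‖x k‖)
        (fun k => ‖inner ℂ (g (p k).2) h‖ * ‖inner ℂ (u (p k).1) w‖)
      rw [← EuclideanSpace.norm_sq_eq] at e4
      refine e2.trans (abs_le_of_sq_le_sq' ?_ (by positivity)).2
      rw [mul_pow]
      refine e4.trans ?_
      gcongr
    have := key (φ x h)
    rw [inner_self_eq_norm_sq_to_K] at this
    simp only [Complex.coe_algebraMap, norm_pow, Complex.norm_real, norm_norm] at this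
    by_cases h0 : ‖φ x h‖ = 0
    · rw [h0]; positivity
    · have hpos : 0 < ‖φ x h‖ := lt_of_le_of_ne (norm_nonneg _) (Ne.symm h0)
      refine le_of_mul_le_mul_right ?_ hpos
      nlinarith
  have hψn : ‖ψ‖ ≤ 1 := by
    refine ContinuousLinearMap.opNorm_le_bound _ zero_le_one fun Y => ?_
    rw [one_mul]
    refine (abs_le_of_sq_le_sq' ?_ (norm_nonneg _)).2
    rw [EuclideanSpace.norm_sq_eq]
    have e1 : ∀ k, ‖ψ Y k‖ ^ 2 ≤ (l (p k).1 ^ 4 / 2 + μ (p k).2 ^ 4 / 2) *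
        ‖inner ℂ (e (p k).1) (Y (f (p k).2))‖ ^ 2 := by
      intro k
      rw [hψa, norm_mul, mul_pow, Complex.norm_real, Real.norm_eq_abs, sq_abs]
      gcongr
      nlinarith [sq_nonneg (l (p k).1 ^ 2 - μ (p k).2 ^ 2)]
    refine (Finset.sum_le_sum fun k _ => e1 k).trans ?_
    refine (sum_comp_le p hp (fun q => (l q.1 ^ 4 / 2 + μ q.2 ^ 4 / 2) *
        ‖inner ℂ (e q.1) (Y (f q.2))‖ ^ 2) (fun q => by positivity)).trans ?_
    have r1 : ∀ i, ∑ j, ‖inner ℂ (e i) (Y (f j))‖ ^ 2 ≤ ‖Y‖ ^ 2 := by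
      intro i
      have h1 := hf.sum_inner_products_le (adjoint Y (e i)) (s := Finset.univ)
      have h2 : ‖adjoint Y (e i)‖ ≤ ‖Y‖ := by
        have := (adjoint Y).le_opNorm (e i)
        rw [he.1 i, mul_one] at this
        rwa [LinearIsometryEquiv.norm_map] at this
      refine le_trans (le_of_eq ?_) (h1.trans (by gcongr))
      refine Finset.sum_congr rfl fun j _ => ?_
      rw [ContinuousLinearMap.adjoint_inner_right, norm_inner_symm]
    have r2 : ∀ j, ∑ i, ‖inner ℂ (e i) (Y (f j))‖ ^ 2 ≤ ‖Y‖ ^ 2 := by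
      intro j
      have h1 := he.sum_inner_products_le (Y (f j)) (s := Finset.univ)
      have h2 : ‖Y (f j)‖ ≤ ‖Y‖ := by
        have := Y.le_opNorm (f j)
        rwa [hf.1 j, mul_one] at this
      exact h1.trans (by gcongr)
    simp_rw [add_mul]
    rw [Finset.sum_add_distrib]
    have s1 : ∑ q : Fin N × Fin M, l q.1 ^ 4 / 2 * ‖inner ℂ (e q.1) (Y (f q.2))‖ ^ 2 ≤
        ‖Y‖ ^ 2 / 2 := by
      rw [Fintype.sum_prod_type]
      have : ∀ i, ∑ j, l i ^ 4 / 2 * ‖inner ℂ (e i) (Y (f j))‖ ^ 2 ≤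
          l i ^ 4 * (‖Y‖ ^ 2 / 2) := by
        intro i
        rw [← Finset.mul_sum]
        nlinarith [mul_le_mul_of_nonneg_left (r1 i) (by positivity : 0 ≤ l i ^ 4 / 2)]
      refine (Finset.sum_le_sum fun i _ => this i).trans ?_
      rw [← Finset.sum_mul]
      exact mul_le_of_le_one_left (by positivity) hl
    have s2 : ∑ q : Fin N × Fin M, μ q.2 ^ 4 / 2 * ‖inner ℂ (e q.1) (Y (f q.2))‖ ^ 2 ≤
        ‖Y‖ ^ 2 / 2 := by
      rw [Fintype.sum_prod_type_right]
      have : ∀ j, ∑ i, μ j ^ 4 / 2 * ‖inner ℂ (e i) (Y (f j))‖ ^ 2 ≤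
          μ j ^ 4 * (‖Y‖ ^ 2 / 2) := by
        intro j
        rw [← Finset.mul_sum]
        nlinarith [mul_le_mul_of_nonneg_left (r2 j) (by positivity : 0 ≤ μ j ^ 4 / 2)]
      refine (Finset.sum_le_sum fun i _ => this i).trans ?_
      rw [← Finset.sum_mul]
      exact mul_le_of_le_one_left (by positivity) hμ
    linarith
  refine le_trans ?_ (hilbertNum_ge (Mop A B) n _ _ φ ψ hφn hψn)
  refine le_approxNum _ t ?_ n hn
  intro x
  have hdiag : ∀ k, ((ψ.comp (Mop A B)).comp φ) x k =
      (((l (p k).1 * σ (p k).1) * (μ (p k).2 * τ (p k).2) : ℝ) : ℂ) * x k := by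
    intro k
    have hM : Mop A B (φ x) (f (p k).2) = A (φ x (B (f (p k).2))) := rfl
    have hx : inner ℂ (u (p k).1) (φ x (g (p k).2)) = x k := by
      rw [hφa, inner_sum, Finset.sum_eq_single k]
      · rw [inner_smul_right, inner_smul_right, inner_self_eq_norm_sq_to_K,
          inner_self_eq_norm_sq_to_K, hu.1, hg.1]
        simp
      · intro m _ hm
        rw [inner_smul_right, inner_smul_right, orthonormal_iff_ite.mp hg,
          orthonormal_iff_ite.mp hu]
        by_cases h1 : (p m).2 = (p k).2
        · by_cases h2 : (p k).1 = (p m).1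
          · exact absurd (hp (Prod.ext h2.symm h1)) hm
          · simp [h2]
        · simp [h1]
      · simp
    rw [ContinuousLinearMap.comp_apply, ContinuousLinearMap.comp_apply, hψa, hM, hB,
      ← ContinuousLinearMap.adjoint_inner_left, hA, map_smul, inner_smul_left, inner_smul_right,
      hx, Complex.conj_ofReal]
    push_cast
    ring
  refine (abs_le_of_sq_le_sq' ?_ (norm_nonneg _)).2
  rw [mul_pow, EuclideanSpace.norm_sq_eq, EuclideanSpace.norm_sq_eq, Finset.mul_sum]
  refine Finset.sum_le_sum fun k _ => ?_
  rw [hdiag, norm_mul, mul_pow, Complex.norm_real, Real.norm_eq_abs, sq_abs]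
  gcongr
  exact ht k

end schmidt

/-- combinatorics of the decreasing rearrangement -/
lemma exists_finset_of_lt (α β : ℕ → ℂ) (C : ℝ) (hC : ∀ i j, ‖α i‖ * ‖β j‖ ≤ C) (n : ℕ) (t : ℝ)
    (ht : t < tensorSeq α β n) :
    ∃ F : Finset (ℕ × ℕ), F.card = n + 1 ∧ ∀ q ∈ F, t < ‖α q.1‖ * ‖β q.2‖ := by
  classical
  have hlt : tensorSum α β n + t < tensorSum α β (n + 1) := by
    unfold tensorSeq at ht; linarith
  have hne : ((fun F : Finset (ℕ × ℕ) => ∑ p ∈ F, ‖α p.1‖ * ‖β p.2‖) ''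
      {F | F.card = n + 1}).Nonempty := by
    obtain ⟨F, hF⟩ := Infinite.exists_subset_card_eq (ℕ × ℕ) (n + 1)
    exact ⟨_, F, hF, rfl⟩
  obtain ⟨_, ⟨F, hF, rfl⟩, hFl⟩ := exists_lt_of_lt_csSup hne hlt
  refine ⟨F, hF, fun q hq => ?_⟩
  have hb : ∑ p ∈ F.erase q, ‖α p.1‖ * ‖β p.2‖ ≤ tensorSum α β n := by
    refine le_csSup ⟨n * C, ?_⟩ ⟨F.erase q, ?_, rfl⟩
    · rintro _ ⟨G, hG, rfl⟩
      have := Finset.sum_le_card_nsmul G (fun p => ‖α p.1‖ * ‖β p.2‖) C (fun p _ => hC _ _)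
      rw [nsmul_eq_mul] at this
      rwa [show G.card = n from hG] at this
    · change (F.erase q).card = n
      rw [Finset.card_erase_of_mem hq, show F.card = n + 1 from hF]
      rfl
  have hs := Finset.add_sum_erase F (fun p => ‖α p.1‖ * ‖β p.2‖) hq
  simp only at hs hFl
  linarith

lemma exists_schmidt_data {H : Type u} [NormedAddCommGroup H] [InnerProductSpace ℂ H]
    [CompleteSpace H] (A : H →L[ℂ] H) (hA : IsCompactOperator ⇑A) (s : Finset ℕ)
    (hs : ∀ i ∈ s, 0 < sSeq A i) :
    ∃ (N : ℕ) (u e : Fin N → H) (σ : Fin N → ℝ), Orthonormal ℂ u ∧ Orthonormal ℂ e ∧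
      (∀ i ∈ s, i < N) ∧ (∀ i, A (u i) = (σ i : ℂ) • e i) ∧
      (∀ i, adjoint A (e i) = (σ i : ℂ) • u i) ∧
      ∀ i : Fin N, sSeq A i ≤ σ i := by
  obtain ⟨N, hN, hsN⟩ : ∃ N, (N = 0 ∨ 0 < approxNum A N) ∧ ∀ i ∈ s, i < N := by
    rcases s.eq_empty_or_nonempty with rfl | hne
    · exact ⟨0, Or.inl rfl, by simp⟩
    · exact ⟨s.max' hne + 1, Or.inr (hs _ (s.max'_mem hne)),
        fun i hi => Nat.lt_succ_of_le (s.le_max' i hi)⟩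
  obtain ⟨u, e, σ, h1, h2, -, h4, h5, h6⟩ := exists_schmidt N A hA hN
  exact ⟨N, u, e, σ, h1, h2, hsN, h4, h5, h6⟩

/-- Let `A, B` be compact operators on a Hilbert space `H` and let
`λ, μ` be nonnegative sequences of `ℓ₄`-norm one.  Then
`hₙ(M_{A,B}) ≥ ((λ·s(A)) ⊗ (μ·s(B)))ₙ` for every `n ≥ 1`. -/
theorem hilbertNum_Mop_ge_weighted {H : Type u} [NormedAddCommGroup H]
    [InnerProductSpace ℂ H] [CompleteSpace H]
    (A B : H →L[ℂ] H) (hA : IsCompactOperator ⇑A) (hB : IsCompactOperator ⇑B)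
    (l μ : ℕ → ℝ) (hl0 : ∀ n, 0 ≤ l n) (hμ0 : ∀ n, 0 ≤ μ n)
    (hl4 : Summable fun n => l n ^ 4) (hμ4 : Summable fun n => μ n ^ 4)
    (hlnorm : ∑' n, l n ^ 4 = 1) (hμnorm : ∑' n, μ n ^ 4 = 1) :
    ∀ n : ℕ,
      tensorSeq (toC fun k => l k * sSeq A k) (toC fun k => μ k * sSeq B k) n ≤
        hilbertNum (Mop A B) (n + 1) := by
  intro n
  have hlk : ∀ k, l k ≤ 1 := by
    intro k
    have h1 : l k ^ 4 ≤ 1 := hlnorm ▸ hl4.le_tsum k (fun j _ => by positivity)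
    exact (pow_le_one_iff_of_nonneg (hl0 k) (by norm_num)).mp h1
  have hμk : ∀ k, μ k ≤ 1 := by
    intro k
    have h1 : μ k ^ 4 ≤ 1 := hμnorm ▸ hμ4.le_tsum k (fun j _ => by positivity)
    exact (pow_le_one_iff_of_nonneg (hμ0 k) (by norm_num)).mp h1
  have hsA : ∀ k, 0 ≤ sSeq A k := fun k => approxNum_nonneg _ _
  have hsB : ∀ k, 0 ≤ sSeq B k := fun k => approxNum_nonneg _ _
  have hnA : ∀ k, ‖toC (fun k => l k * sSeq A k) k‖ = l k * sSeq A k := fun k => by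
    rw [toC, Complex.norm_real, Real.norm_of_nonneg (mul_nonneg (hl0 k) (hsA k))]
  have hnB : ∀ k, ‖toC (fun k => μ k * sSeq B k) k‖ = μ k * sSeq B k := fun k => by
    rw [toC, Complex.norm_real, Real.norm_of_nonneg (mul_nonneg (hμ0 k) (hsB k))]
  refine le_of_forall_lt_imp_le_of_dense fun t ht => ?_
  by_cases ht0 : t < 0
  · exact ht0.le.trans (hilbertNum_nonneg _ _)
  push Not at ht0
  obtain ⟨F, hF, hFt⟩ := exists_finset_of_lt _ _ (‖A‖ * ‖B‖) (by
    intro i j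
    rw [hnA, hnB]
    have a1 : l i * sSeq A i ≤ ‖A‖ :=
      (mul_le_of_le_one_left (hsA i) (hlk i)).trans (approxNum_le_norm A i)
    have a2 : μ j * sSeq B j ≤ ‖B‖ :=
      (mul_le_of_le_one_left (hsB j) (hμk j)).trans (approxNum_le_norm B j)
    exact mul_le_mul a1 a2 (mul_nonneg (hμ0 j) (hsB j)) (norm_nonneg _)) n t ht
  simp only [hnA, hnB] at hFt
  have hposA : ∀ i ∈ F.image Prod.fst, 0 < sSeq A i := by
    intro i hi
    obtain ⟨q, hq, rfl⟩ := Finset.mem_image.mp hi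
    refine lt_of_le_of_ne (hsA _) fun h => ?_
    have := hFt q hq
    rw [← h] at this
    simp at this
    linarith
  have hposB : ∀ i ∈ F.image Prod.snd, 0 < sSeq B i := by
    intro i hi
    obtain ⟨q, hq, rfl⟩ := Finset.mem_image.mp hi
    refine lt_of_le_of_ne (hsB _) fun h => ?_
    have := hFt q hq
    rw [← h] at this
    simp at this
    linarith
  obtain ⟨N, u, e, σ, hu, he, hN, -, hA2, hσ⟩ := exists_schmidt_data A hA _ hposA
  obtain ⟨M, f, g, τ, hf, hg, hM, hB1, -, hτ⟩ := exists_schmidt_data B hB _ hposB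
  refine core (ι := ULift F)
    (fun k => (⟨k.down.1.1, hN _ (Finset.mem_image_of_mem _ k.down.2)⟩,
      ⟨k.down.1.2, hM _ (Finset.mem_image_of_mem _ k.down.2)⟩)) ?_ ?_
    A B u e f g σ τ hu he hf hg hA2 hB1 (fun i => l i) (fun j => μ j) ?_ ?_ t ht0 ?_
  · intro a b hab
    simp only [Prod.mk.injEq, Fin.mk.injEq] at hab
    exact ULift.ext _ _ (Subtype.ext (Prod.ext hab.1 hab.2))
  · simp [hF]
  · rw [Fin.sum_univ_eq_sum_range (fun i => l i ^ 4), ← hlnorm]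
    exact hl4.sum_le_tsum _ (fun j _ => by positivity)
  · rw [Fin.sum_univ_eq_sum_range (fun i => μ i ^ 4), ← hμnorm]
    exact hμ4.sum_le_tsum _ (fun j _ => by positivity)
  · rintro ⟨⟨⟨i, j⟩, hk⟩⟩
    refine (hFt _ hk).le.trans ?_
    have a1 := hσ ⟨i, hN _ (Finset.mem_image_of_mem _ hk)⟩
    have a2 := hτ ⟨j, hM _ (Finset.mem_image_of_mem _ hk)⟩
    have b1 := hl0 i
    have b2 := hμ0 j
    have c1 := hsA i
    have c2 := hsB j
    dsimp only at a1 a2 ⊢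
    exact mul_le_mul (mul_le_mul_of_nonneg_left a1 b1) (mul_le_mul_of_nonneg_left a2 b2)
      (mul_nonneg b2 c2) (mul_nonneg b1 (c1.trans a1))
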